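/- Let P be a closed path polyomino not containing any W-pentomino. Let R be the set of all LD-horizontal and LD-vertical skew tetrominoes contained in P and let Y = ⋃_{C∈R} {x_C, y_C} ⊆ V(P). Then the set G of all inner 2-minors of P is the reduced Gröbner basis of the polyomino ideal I_P with respect to the monomial order <^Y_lex. -/

import Mathlib

namespace ClosedPathPaper

open MvPolynomial

/-- Lattice points of `ℤ²`; a cell is identified with its lower left corner. -/
abbrev Pt : Type := ℤ × ℤ

/-- The four vertices (corners) of the unit cell with lower left corner `a`. -/
def cellVerts (a : Pt) : Set Pt :=
  {a, (a.1 + 1, a.2), (a.1, a.2 + 1), (a.1 + 1, a.2 + 1)}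

/-- The vertex set `V(P)` of a collection of cells `P`. -/
def VP (P : Finset Pt) : Set Pt := ⋃ a ∈ P, cellVerts a

/-- `[a,b]` is a proper interval and every cell contained in it belongs to `P`. -/
def IsInnerInterval (P : Finset Pt) (a b : Pt) : Prop :=
  a.1 < b.1 ∧ a.2 < b.2 ∧
    ∀ c : Pt, a.1 ≤ c.1 → c.1 < b.1 → a.2 ≤ c.2 → c.2 < b.2 → c ∈ P

/-- The four corners of the proper interval `[a,b]`:
diagonal corners `a, b` and anti-diagonal corners `c = (a.1, b.2)`, `d = (b.1, a.2)`. -/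
def cornersOf (a b : Pt) : Finset Pt := {a, b, (a.1, b.2), (b.1, a.2)}

/-- The inner 2-minor `f_{a,b} = x_a x_b - x_c x_d` attached to the inner interval `[a,b]`. -/
noncomputable def innerMinor (K : Type*) [Field K] (a b : Pt) : MvPolynomial Pt K :=
  X a * X b - X (a.1, b.2) * X (b.1, a.2)

/-- The set `G` of all inner 2-minors of `P`. -/
def minorsSet (K : Type*) [Field K] (P : Finset Pt) : Set (MvPolynomial Pt K) :=
  {f | ∃ a b : Pt, IsInnerInterval P a b ∧ f = innerMinor K a b}

/-- The polyomino ideal `I_P`. -/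
noncomputable def polyoIdeal (K : Type*) [Field K] (P : Finset Pt) :
    Ideal (MvPolynomial Pt K) :=
  Ideal.span (minorsSet K P)

/-! ### Monomial orders -/

/-- Strict lexicographic comparison of exponent vectors induced by the
(strict total) order `po` on the variables. -/
def lexLt (po : Pt → Pt → Prop) (u v : Pt →₀ ℕ) : Prop :=
  ∃ w : Pt, u w < v w ∧ ∀ w' : Pt, po w w' → u w' = v w'

def lexLe (po : Pt → Pt → Prop) (u v : Pt →₀ ℕ) : Prop := u = v ∨ lexLt po u v

/-- `m` is the leading monomial of `f` with respect to the lexicographic order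
induced by `po`. -/
def IsLM {K : Type*} [Field K] (po : Pt → Pt → Prop) (f : MvPolynomial Pt K)
    (m : Pt →₀ ℕ) : Prop :=
  m ∈ f.support ∧ ∀ m' ∈ f.support, lexLe po m' m

/-- `sp` is the S-polynomial of `f` and `g` with respect to the lexicographic
order induced by `po`. -/
def IsSPoly {K : Type*} [Field K] (po : Pt → Pt → Prop) (f g sp : MvPolynomial Pt K) : Prop :=
  ∃ mf mg : Pt →₀ ℕ, IsLM po f mf ∧ IsLM po g mg ∧
    sp = monomial (mf ⊔ mg - mf) (f.coeff mf)⁻¹ * f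
       - monomial (mf ⊔ mg - mg) (g.coeff mg)⁻¹ * g

/-- `h` has a standard expression with respect to `G`, i.e. `h` reduces to `0`
modulo `G` with respect to the lexicographic order induced by `po`. -/
def ReducesToZero {K : Type*} [Field K] (po : Pt → Pt → Prop)
    (G : Set (MvPolynomial Pt K)) (h : MvPolynomial Pt K) : Prop :=
  ∃ (F : Finset (MvPolynomial Pt K)) (q : MvPolynomial Pt K → MvPolynomial Pt K),
    ↑F ⊆ G ∧ h = ∑ g ∈ F, q g * g ∧
    ∀ g ∈ F, ∀ m, IsLM po (q g * g) m → ∃ mh, IsLM po h mh ∧ lexLe po m mh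

/-- The exponent vector of `x_u x_v x_w`. -/
noncomputable def mono3 (u v w : Pt) : Pt →₀ ℕ :=
  Finsupp.single u 1 + Finsupp.single v 1 + Finsupp.single w 1

/-- The leading monomials, viewed as polynomials, of the members of `G`. -/
def leadingMonomials {K : Type*} [Field K] (po : Pt → Pt → Prop)
    (G : Set (MvPolynomial Pt K)) : Set (MvPolynomial Pt K) :=
  {f | ∃ g ∈ G, ∃ m, IsLM po g m ∧ f = monomial m (1 : K)}

/-- The initial ideal of `I` with respect to the lexicographic order induced by `po`. -/
noncomputable def initialIdeal {K : Type*} [Field K] (po : Pt → Pt → Prop)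
    (I : Ideal (MvPolynomial Pt K)) : Ideal (MvPolynomial Pt K) :=
  Ideal.span (leadingMonomials po (I : Set (MvPolynomial Pt K)))

/-- `G` is a Gröbner basis of `I`. -/
def IsGroebnerBasis {K : Type*} [Field K] (po : Pt → Pt → Prop)
    (G : Set (MvPolynomial Pt K)) (I : Ideal (MvPolynomial Pt K)) : Prop :=
  Ideal.span G = I ∧ Ideal.span (leadingMonomials po G) = initialIdeal po I

/-- `G` is the reduced Gröbner basis of `I` (up to normalizing signs). -/
def IsReducedGroebnerBasis {K : Type*} [Field K] (po : Pt → Pt → Prop)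
    (G : Set (MvPolynomial Pt K)) (I : Ideal (MvPolynomial Pt K)) : Prop :=
  IsGroebnerBasis po G I ∧
  (∀ g ∈ G, ∃ m, IsLM po g m ∧ (g.coeff m = 1 ∨ g.coeff m = -1)) ∧
  (∀ g ∈ G, ∀ g' ∈ G, g' ≠ g → ∀ m ∈ g.support, ∀ m', IsLM po g' m' → ¬ m' ≤ m)

/-! ### Closed paths and special configurations -/

/-- Two cells share a common edge. -/
def cellAdj (a b : Pt) : Prop :=
  b = (a.1 + 1, a.2) ∨ b = (a.1 - 1, a.2) ∨ b = (a.1, a.2 + 1) ∨ b = (a.1, a.2 - 1)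

/-- `P` is a closed path polyomino. -/
def IsClosedPath (P : Finset Pt) : Prop :=
  ∃ n : ℕ, 5 < n ∧ ∃ A : ZMod n → Pt,
    Function.Injective A ∧
    (∀ i, cellAdj (A i) (A (i + 1))) ∧
    (∀ i j : ZMod n, j ≠ i - 2 → j ≠ i - 1 → j ≠ i → j ≠ i + 1 → j ≠ i + 2 →
      cellVerts (A i) ∩ cellVerts (A j) = ∅) ∧
    ∀ c : Pt, c ∈ P ↔ ∃ i, A i = c

/-- The horizontal block of rank `m` whose leftmost cell is `a`. -/
def hBlockCells (a : Pt) (m : ℕ) : Finset Pt :=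
  (Finset.range m).image fun t : ℕ => (a.1 + (t : ℤ), a.2)

/-- The vertical block of rank `m` whose bottom cell is `a`. -/
def vBlockCells (a : Pt) (m : ℕ) : Finset Pt :=
  (Finset.range m).image fun t : ℕ => (a.1, a.2 + (t : ℤ))

/-- The vertex set of a finite set of cells. -/
def vertsOfCells (s : Finset Pt) : Set Pt := ⋃ c ∈ s, cellVerts c

/-- A W-pentomino of `P`: a horizontal block of rank two with leftmost cell `a₁`, a
vertical block of rank two with bottom cell `a₂`, and a middle cell `A` not belonging to the
two blocks, such that the vertex sets of the two blocks meet exactly in the lower right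
corner of `A`. -/
def IsWPentomino (P : Finset Pt) (a₁ a₂ A : Pt) : Prop :=
  hBlockCells a₁ 2 ⊆ P ∧ vBlockCells a₂ 2 ⊆ P ∧ A ∈ P ∧
  A ∉ hBlockCells a₁ 2 ∪ vBlockCells a₂ 2 ∧
  vertsOfCells (hBlockCells a₁ 2) ∩ vertsOfCells (vBlockCells a₂ 2) = {(A.1 + 1, A.2)}

/-- An RW-heptomino of `P`: a horizontal block of rank three with leftmost cell `a₁`, a
vertical block of rank three with bottom cell `a₂`, and a middle cell `A` not belonging to
the two blocks, such that the vertex sets of the two blocks meet exactly in the upper left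
corner of `A`. -/
def IsRWHeptomino (P : Finset Pt) (a₁ a₂ A : Pt) : Prop :=
  hBlockCells a₁ 3 ⊆ P ∧ vBlockCells a₂ 3 ⊆ P ∧ A ∈ P ∧
  A ∉ hBlockCells a₁ 3 ∪ vBlockCells a₂ 3 ∧
  vertsOfCells (hBlockCells a₁ 3) ∩ vertsOfCells (vBlockCells a₂ 3) = {(A.1, A.2 + 1)}

/-- An LD-horizontal skew tetromino of `P` (base point `p`): the cells
`p, p+(1,0), p+(1,1), p+(2,1)`. -/
def IsLDhTetromino (P : Finset Pt) (p : Pt) : Prop :=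
  p ∈ P ∧ (p.1 + 1, p.2) ∈ P ∧ (p.1 + 1, p.2 + 1) ∈ P ∧ (p.1 + 2, p.2 + 1) ∈ P

/-- An LD-vertical skew tetromino of `P` (base point `p`): the cells
`p, p+(0,1), p+(1,1), p+(1,2)`. -/
def IsLDvTetromino (P : Finset Pt) (p : Pt) : Prop :=
  p ∈ P ∧ (p.1, p.2 + 1) ∈ P ∧ (p.1 + 1, p.2 + 1) ∈ P ∧ (p.1 + 1, p.2 + 2) ∈ P

/-- An LD-horizontal skew hexomino of `P` (base point `p`): the cells
`p, p+(1,0), p+(2,0), p+(2,1), p+(3,1), p+(4,1)`. -/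
def IsLDhHexomino (P : Finset Pt) (p : Pt) : Prop :=
  p ∈ P ∧ (p.1 + 1, p.2) ∈ P ∧ (p.1 + 2, p.2) ∈ P ∧
  (p.1 + 2, p.2 + 1) ∈ P ∧ (p.1 + 3, p.2 + 1) ∈ P ∧ (p.1 + 4, p.2 + 1) ∈ P

/-- An LD-vertical skew hexomino of `P` (base point `p`): the cells
`p, p+(0,1), p+(0,2), p+(1,2), p+(1,3), p+(1,4)`. -/
def IsLDvHexomino (P : Finset Pt) (p : Pt) : Prop :=
  p ∈ P ∧ (p.1, p.2 + 1) ∈ P ∧ (p.1, p.2 + 2) ∈ P ∧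
  (p.1 + 1, p.2 + 2) ∈ P ∧ (p.1 + 1, p.2 + 3) ∈ P ∧ (p.1 + 1, p.2 + 4) ∈ P

/-- The total order `<¹` on `ℤ²`. -/
def lt1 (a b : Pt) : Prop := a.1 < b.1 ∨ (a.1 = b.1 ∧ a.2 < b.2)

/-- The P-order `<^Y` attached to a set `Y` of vertices. -/
def Ylt (Y : Set Pt) (a b : Pt) : Prop :=
  (a ∉ Y ∧ b ∈ Y) ∨ (a ∉ Y ∧ b ∉ Y ∧ lt1 a b) ∨ (a ∈ Y ∧ b ∈ Y ∧ lt1 a b)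


/-- The set `Y = ⋃_{C ∈ R} {x_C, y_C}` over all LD-horizontal and LD-vertical skew
tetrominoes `C` contained in `P`. -/
def YtetXY (P : Finset Pt) : Set Pt :=
  {v | ∃ p : Pt, IsLDhTetromino P p ∧ (v = (p.1 + 1, p.2 + 2) ∨ v = (p.1 + 2, p.2 + 2))} ∪
  {v | ∃ p : Pt, IsLDvTetromino P p ∧ (v = (p.1, p.2 + 2) ∨ v = (p.1, p.2 + 1))}


/-! ### Local combinatorics -/

structure Loc (M : ℤ → ℤ → Prop) : Prop where
  n1 : ∀ x y, M x y → M (x-1) y → M (x+1) y → M x (y+1) → False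
  n2 : ∀ x y, M x y → M (x-1) y → M (x+1) y → M x (y-1) → False
  n3 : ∀ x y, M x y → M (x-1) y → M x (y-1) → M x (y+1) → False
  n4 : ∀ x y, M x y → M (x+1) y → M x (y-1) → M x (y+1) → False
  sq : ∀ x y, M x y → M (x+1) y → M x (y+1) → M (x+1) (y+1) → False
  dg1 : ∀ x y, M x y → M (x+1) (y+1) → M (x+1) y ∨ M x (y+1)
  dg2 : ∀ x y, M x (y+1) → M (x+1) y → M x y ∨ M (x+1) (y+1)
  tl : ∀ x y, M x y → M (x+1) y → M x (y-1) →
    (M (x+2) y ∧ M (x-1) (y-1)) ∨ (M (x+1) (y+1) ∧ M x (y-2))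

def YM (M : ℤ → ℤ → Prop) (x y : ℤ) : Prop :=
  (M (x-1) (y-2) ∧ M x (y-2) ∧ M x (y-1) ∧ M (x+1) (y-1)) ∨
  (M (x-2) (y-2) ∧ M (x-1) (y-2) ∧ M (x-1) (y-1) ∧ M x (y-1)) ∨
  (M x (y-2) ∧ M x (y-1) ∧ M (x+1) (y-1) ∧ M (x+1) y) ∨
  (M x (y-1) ∧ M x y ∧ M (x+1) y ∧ M (x+1) (y+1))

lemma mem_Y_iff (P : Finset Pt) (x y : ℤ) :
    (x, y) ∈ YtetXY P ↔ YM (fun a b => (a, b) ∈ P) x y := by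
  unfold YtetXY YM IsLDhTetromino IsLDvTetromino
  constructor
  · rintro (⟨⟨p, q⟩, h, h' | h'⟩ | ⟨⟨p, q⟩, h, h' | h'⟩) <;> rw [Prod.mk.injEq] at h' <;>
      obtain ⟨rfl, rfl⟩ := h'
    · left; convert h using 4 <;> ring_nf
    · right; left; convert h using 4 <;> ring_nf
    · right; right; left; convert h using 4 <;> ring_nf
    · right; right; right; convert h using 4 <;> ring_nf
  · rintro (h | h | h | h)
    · left; refine ⟨(x-1, y-2), ?_, Or.inl (by ext <;> simp)⟩
      convert h using 4 <;> ring_nf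
    · left; refine ⟨(x-2, y-2), ?_, Or.inr (by ext <;> simp)⟩
      convert h using 4 <;> ring_nf
    · right; refine ⟨(x, y-2), ?_, Or.inl (by ext <;> simp)⟩
      convert h using 4 <;> ring_nf
    · right; refine ⟨(x, y-1), ?_, Or.inr (by ext <;> simp)⟩
      convert h using 4 <;> ring_nf

section
variable {M : ℤ → ℤ → Prop} (H : Loc M)

lemma Mc {M : ℤ → ℤ → Prop} {x y x' y' : ℤ} (h : M x y) (hx : x = x') (hy : y = y') :
    M x' y' := by subst hx; subst hy; exact h

include H

/-- lower right corners are not in Y -/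
lemma C1 {x y : ℤ} (h : M x y) : ¬ YM M (x+1) y := by
  have a1 := H.dg2 x (y-1)
  have a2 := H.n1 (x+1) (y-1)
  have a3 := H.n4 (x+1) (y-1)
  have a4 := H.n2 (x+1) (y-1)
  have a5 := H.n4 x (y-1)
  have a6 := H.n2 (x+1) y
  unfold YM
  ring_nf at *
  grind

/-- upper left corner of a top right cell -/
lemma C2 {x y : ℤ} (h : M x y) (hl : M (x-1) y) (hd : M x (y-1)) : ¬ YM M x (y+1) := by
  have a1 := H.sq (x-1) (y-1)
  have a2 := H.n2 x y
  have a3 := H.n3 x y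
  unfold YM
  ring_nf at *
  grind

/-- upper right corner of a cell with left neighbour -/
lemma C3 {x y : ℤ} (h : M x y) (hl : M (x-1) y) : ¬ YM M (x+1) (y+1) := by
  have a1 := H.dg1 x y
  have a2 := H.n2 x y
  have a3 := H.n2 (x+1) y
  have a4 := H.n3 (x+1) y
  have a5 := H.tl (x+1) (y+1)
  have a6 := H.n1 (x+2) (y+1)
  unfold YM
  ring_nf at *
  grind

/-- upper right corner of a TL cell of type v -/
lemma C4 {x y : ℤ} (h : M x y) (hr : M (x+1) y) (hd : M x (y-1)) (hdd : M x (y-2)) :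
    ¬ YM M (x+1) (y+1) := by
  have a1 := H.tl x y h hr hd
  have a2 := H.n3 x (y-1)
  have a3 := H.n4 (x+1) y
  have a4 := H.n3 (x+1) y
  have a5 := H.sq x (y-1)
  have a6 := H.tl (x+1) (y+1)
  have a7 := H.n1 (x+2) (y+1)
  unfold YM
  ring_nf at *
  grind

/-- lower left corner of a TL cell of type h -/
lemma C5 {x y : ℤ} (h : M x y) (hr : M (x+1) y) (hd : M x (y-1)) (hrr : M (x+2) y) :
    ¬ YM M x y := by
  have a1 := H.tl x y h hr hd
  have a2 := H.n1 (x+1) y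
  have a3 := H.n1 x (y-1)
  have a4 := H.n3 x (y-1)
  have a5 := H.sq x (y-1)
  have a6 := H.tl (x-1) (y-1)
  have a7 := H.n3 (x-1) (y-2)
  unfold YM
  ring_nf at *
  grind

end

/-! ### Local facts about closed paths -/

lemma cellAdj_symm {a b : Pt} (h : cellAdj a b) : cellAdj b a := by
  obtain ⟨a1, a2⟩ := a
  obtain ⟨b1, b2⟩ := b
  simp only [cellAdj, Prod.mk.injEq] at *
  omega

lemma cellAdj_ne {a b : Pt} (h : cellAdj a b) : a ≠ b := by
  rintro rfl
  obtain ⟨a1, a2⟩ := a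
  simp only [cellAdj, Prod.mk.injEq] at *
  omega

lemma cellAdj_tri {a b c : Pt} (h : cellAdj a b) (h' : cellAdj b c) (h'' : cellAdj a c) :
    False := by
  obtain ⟨a1, a2⟩ := a
  obtain ⟨b1, b2⟩ := b
  obtain ⟨c1, c2⟩ := c
  simp only [cellAdj, Prod.mk.injEq] at *
  omega

lemma cellAdj_verts {a b : Pt} (h : cellAdj a b) : ∃ v, v ∈ cellVerts a ∧ v ∈ cellVerts b := by
  obtain ⟨a1, a2⟩ := a
  simp only [cellAdj] at h
  rcases h with rfl | rfl | rfl | rfl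
  · exact ⟨(a1+1, a2), by simp [cellVerts], by simp [cellVerts]⟩
  · exact ⟨(a1, a2), by simp [cellVerts], by simp [cellVerts]⟩
  · exact ⟨(a1, a2+1), by simp [cellVerts], by simp [cellVerts]⟩
  · exact ⟨(a1, a2), by simp [cellVerts], by simp [cellVerts]⟩

lemma cp_facts {P : Finset Pt} (hP : IsClosedPath P) :
    (∀ c ∈ P, ∀ p ∈ P, ∀ q ∈ P, ∀ r ∈ P, cellAdj c p → cellAdj c q → cellAdj c r →
      p = q ∨ p = r ∨ q = r) ∧
    (∀ c ∈ P, ∀ p ∈ P, cellAdj c p → ∃ q ∈ P, q ≠ p ∧ cellAdj c q) ∧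
    (∀ c ∈ P, ∀ d ∈ P, c ≠ d → ¬ cellAdj c d → (∃ v, v ∈ cellVerts c ∧ v ∈ cellVerts d) →
      ∃ e ∈ P, cellAdj c e ∧ cellAdj e d) ∧
    (∀ a ∈ P, ∀ b ∈ P, ∀ c ∈ P, ∀ d ∈ P, cellAdj a b → cellAdj b c → cellAdj c d →
      cellAdj d a → a ≠ c → b ≠ d → False) := by
  obtain ⟨n, hn, A, hinj, hadj, hdis, hmem⟩ := hP
  have share : ∀ i j, (∃ v, v ∈ cellVerts (A i) ∧ v ∈ cellVerts (A j)) →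
      j = i - 2 ∨ j = i - 1 ∨ j = i ∨ j = i + 1 ∨ j = i + 2 := by
    rintro i j ⟨v, hv, hv'⟩
    by_contra! hc
    have := hdis i j hc.1 hc.2.1 hc.2.2.1 hc.2.2.2.1 hc.2.2.2.2
    have h2 : v ∈ cellVerts (A i) ∩ cellVerts (A j) := ⟨hv, hv'⟩
    rw [this] at h2
    exact h2
  have hadj' : ∀ i, cellAdj (A i) (A (i - 1)) := by
    intro i
    have := hadj (i - 1)
    rw [sub_add_cancel] at this
    exact cellAdj_symm this
  have adj : ∀ i j, cellAdj (A i) (A j) → j = i - 1 ∨ j = i + 1 := by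
    intro i j h
    rcases share i j (cellAdj_verts h) with rfl | h1 | rfl | h1 | rfl
    · exfalso
      have h1 := hadj' i
      have h2 := hadj' (i - 1)
      have e : i - 1 - 1 = i - 2 := by ring
      rw [e] at h2
      exact cellAdj_tri h1 h2 h
    · exact Or.inl h1
    · exact absurd rfl (cellAdj_ne h)
    · exact Or.inr h1
    · exfalso
      have h1 := hadj i
      have h2 := hadj (i + 1)
      have e : i + 1 + 1 = i + 2 := by ring
      rw [e] at h2
      exact cellAdj_tri h1 h2 h
  have h4 : (4 : ZMod n) ≠ 0 := by
    intro h
    have : ((4 : ℕ) : ZMod n) = 0 := by exact_mod_cast h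
    rw [ZMod.natCast_eq_zero_iff] at this
    have := Nat.le_of_dvd (by norm_num) this
    omega
  have h2 : (2 : ZMod n) ≠ 0 := by
    intro h
    apply h4
    linear_combination 2 * h
  refine ⟨?_, ?_, ?_, ?_⟩
  · intro c hc p hp q hq r hr h1 h2 h3
    obtain ⟨i, rfl⟩ := (hmem c).1 hc
    obtain ⟨a, rfl⟩ := (hmem p).1 hp
    obtain ⟨b, rfl⟩ := (hmem q).1 hq
    obtain ⟨d, rfl⟩ := (hmem r).1 hr
    rcases adj _ _ h1 with rfl | rfl <;> rcases adj _ _ h2 with rfl | rfl <;>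
      rcases adj _ _ h3 with rfl | rfl <;> simp
  · intro c hc p hp h1
    obtain ⟨i, rfl⟩ := (hmem c).1 hc
    obtain ⟨a, rfl⟩ := (hmem p).1 hp
    rcases adj _ _ h1 with rfl | rfl
    · refine ⟨A (i + 1), (hmem _).2 ⟨_, rfl⟩, ?_, hadj i⟩
      intro h
      have := hinj h
      apply h2
      linear_combination this
    · refine ⟨A (i - 1), (hmem _).2 ⟨_, rfl⟩, ?_, hadj' i⟩
      intro h
      have := hinj h
      apply h2
      linear_combination -this
  · intro c hc d hd hne hna hv
    obtain ⟨i, rfl⟩ := (hmem c).1 hc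
    obtain ⟨j, rfl⟩ := (hmem d).1 hd
    rcases share i j hv with rfl | rfl | rfl | rfl | rfl
    · refine ⟨A (i - 1), (hmem _).2 ⟨_, rfl⟩, hadj' i, ?_⟩
      have h2 := hadj' (i - 1)
      have e : i - 1 - 1 = i - 2 := by ring
      rwa [e] at h2
    · exact absurd (hadj' i) hna
    · exact absurd rfl hne
    · exact absurd (hadj i) hna
    · refine ⟨A (i + 1), (hmem _).2 ⟨_, rfl⟩, hadj i, ?_⟩
      have h2 := hadj (i + 1)
      have e : i + 1 + 1 = i + 2 := by ring
      rwa [e] at h2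
  · intro a ha b hb c hc d hd hab hbc hcd hda hac hbd
    obtain ⟨i, rfl⟩ := (hmem a).1 ha
    obtain ⟨j, rfl⟩ := (hmem b).1 hb
    obtain ⟨k, rfl⟩ := (hmem c).1 hc
    obtain ⟨l, rfl⟩ := (hmem d).1 hd
    rcases adj _ _ hab with rfl | rfl <;> rcases adj _ _ hbc with rfl | rfl <;>
      rcases adj _ _ (cellAdj_symm hda) with rfl | rfl <;>
      rcases adj _ _ (cellAdj_symm hcd) with h | h
    all_goals first
      | exact hbd rfl
      | exact hac (by congr 1; ring1)
      | exact hac (by congr 1; linear_combination h)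
      | exact hac (by congr 1; linear_combination -h)
      | exact h4 (by linear_combination h)
      | exact h4 (by linear_combination -h)

lemma adjR (x y : ℤ) : cellAdj (x, y) (x+1, y) := Or.inl rfl
lemma adjL (x y : ℤ) : cellAdj (x, y) (x-1, y) := Or.inr (Or.inl rfl)
lemma adjU (x y : ℤ) : cellAdj (x, y) (x, y+1) := Or.inr (Or.inr (Or.inl rfl))
lemma adjD (x y : ℤ) : cellAdj (x, y) (x, y-1) := Or.inr (Or.inr (Or.inr rfl))

lemma loc_of_closedPath {P : Finset Pt} (hP : IsClosedPath P)
    (hW : ¬ ∃ a₁ a₂ A : Pt, IsWPentomino P a₁ a₂ A) : Loc (fun a b => (a, b) ∈ P) := by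
  obtain ⟨F1, F2, F3, F4⟩ := cp_facts hP
  have sq : ∀ x y : ℤ, (x, y) ∈ P → (x+1, y) ∈ P → (x, y+1) ∈ P → (x+1, y+1) ∈ P → False := by
    intro x y h1 h2 h3 h4
    refine F4 _ h1 _ h2 _ h4 _ h3 (adjR x y) (adjU _ _) (cellAdj_symm (adjR _ _))
      (cellAdj_symm (adjU _ _)) ?_ ?_ <;> simp
  refine ⟨?_, ?_, ?_, ?_, sq, ?_, ?_, ?_⟩
  · intro x y h a b c
    have := F1 _ h _ a _ b _ c (adjL _ _) (adjR _ _) (adjU _ _)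
    simp only [Prod.mk.injEq] at this
    omega
  · intro x y h a b c
    have := F1 _ h _ a _ b _ c (adjL _ _) (adjR _ _) (adjD _ _)
    simp only [Prod.mk.injEq] at this
    omega
  · intro x y h a b c
    have := F1 _ h _ a _ b _ c (adjL _ _) (adjD _ _) (adjU _ _)
    simp only [Prod.mk.injEq] at this
    omega
  · intro x y h a b c
    have := F1 _ h _ a _ b _ c (adjR _ _) (adjD _ _) (adjU _ _)
    simp only [Prod.mk.injEq] at this
    omega
  · intro x y h1 h2
    obtain ⟨⟨e1, e2⟩, he, ha, hb⟩ := F3 _ h1 _ h2 (by simp) (by simp [cellAdj])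
      ⟨(x+1, y+1), by simp [cellVerts], by simp [cellVerts]⟩
    have : (e1 = x+1 ∧ e2 = y) ∨ (e1 = x ∧ e2 = y+1) := by
      simp only [cellAdj, Prod.mk.injEq] at ha hb
      omega
    rcases this with ⟨rfl, rfl⟩ | ⟨rfl, rfl⟩
    · exact Or.inl he
    · exact Or.inr he
  · intro x y h1 h2
    obtain ⟨⟨e1, e2⟩, he, ha, hb⟩ := F3 _ h1 _ h2 (by simp) (by simp [cellAdj])
      ⟨(x+1, y+1), by simp [cellVerts], by simp [cellVerts]⟩
    have : (e1 = x ∧ e2 = y) ∨ (e1 = x+1 ∧ e2 = y+1) := by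
      simp only [cellAdj, Prod.mk.injEq] at ha hb
      omega
    rcases this with ⟨rfl, rfl⟩ | ⟨rfl, rfl⟩
    · exact Or.inl he
    · exact Or.inr he
  · intro x y h hr hd
    have hs : (x+1, y-1) ∉ P := by
      intro hs
      apply sq x (y-1) hd hs <;> simpa
    obtain ⟨⟨e1, e2⟩, he, hne, ha⟩ := F2 _ hr _ h (cellAdj_symm (adjR _ _))
    obtain ⟨⟨f1, f2⟩, hf, hne', hb⟩ := F2 _ hd _ h (cellAdj_symm (adjD _ _))
    have e : (e1 = x+2 ∧ e2 = y) ∨ (e1 = x+1 ∧ e2 = y+1) := by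
      have : ¬ (e1 = x+1 ∧ e2 = y-1) := by rintro ⟨rfl, rfl⟩; exact hs he
      simp only [cellAdj, Prod.mk.injEq, ne_eq] at ha hne
      omega
    have f : (f1 = x-1 ∧ f2 = y-1) ∨ (f1 = x ∧ f2 = y-2) := by
      have : ¬ (f1 = x+1 ∧ f2 = y-1) := by rintro ⟨rfl, rfl⟩; exact hs hf
      simp only [cellAdj, Prod.mk.injEq, ne_eq] at hb hne'
      omega
    rcases e with ⟨k1, k2⟩ | ⟨k1, k2⟩ <;> rcases f with ⟨k3, k4⟩ | ⟨k3, k4⟩ <;>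
      rw [k1, k2] at he <;> rw [k3, k4] at hf
    · exact Or.inl ⟨he, hf⟩
    · exfalso
      apply hW
      refine ⟨(x+1, y), (x, y-2), (x, y), ?_, ?_, h, ?_, ?_⟩
      · intro c hc
        simp only [hBlockCells, Finset.mem_image, Finset.mem_range] at hc
        obtain ⟨t, ht, rfl⟩ := hc
        interval_cases t
        · simpa using hr
        · exact Mc (M := fun a b => (a, b) ∈ P) he (by push_cast; omega) (by push_cast; omega)
      · intro c hc
        simp only [vBlockCells, Finset.mem_image, Finset.mem_range] at hc
        obtain ⟨t, ht, rfl⟩ := hc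
        interval_cases t
        · simpa using hf
        · exact Mc (M := fun a b => (a, b) ∈ P) hd (by push_cast; omega) (by push_cast; omega)
      · simp [hBlockCells, vBlockCells, Finset.range_add_one]
        try omega
      · ext ⟨u, v⟩
        simp [vertsOfCells, hBlockCells, vBlockCells, Finset.range_add_one, cellVerts]
        omega
    · exfalso
      apply hW
      refine ⟨(x-1, y-1), (x+1, y), (x, y), ?_, ?_, h, ?_, ?_⟩
      · intro c hc
        simp only [hBlockCells, Finset.mem_image, Finset.mem_range] at hc
        obtain ⟨t, ht, rfl⟩ := hc
        interval_cases t
        · simpa using hf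
        · exact Mc (M := fun a b => (a, b) ∈ P) hd (by push_cast; omega) (by push_cast; omega)
      · intro c hc
        simp only [vBlockCells, Finset.mem_image, Finset.mem_range] at hc
        obtain ⟨t, ht, rfl⟩ := hc
        interval_cases t
        · simpa using hr
        · exact Mc (M := fun a b => (a, b) ∈ P) he (by push_cast; omega) (by push_cast; omega)
      · simp [hBlockCells, vBlockCells, Finset.range_add_one]
        try omega
      · ext ⟨u, v⟩
        simp [vertsOfCells, hBlockCells, vBlockCells, Finset.range_add_one, cellVerts]
        omega
    · exact Or.inr ⟨he, hf⟩

/-! ### The rewriting system -/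

noncomputable def ee (p : Pt) : Pt →₀ ℕ := Finsupp.single p 1

def Inn (M : ℤ → ℤ → Prop) (i j k l : ℤ) : Prop :=
  i < k ∧ j < l ∧ ∀ x y, i ≤ x → x < k → j ≤ y → y < l → M x y

def Top (M : ℤ → ℤ → Prop) (i k l : ℤ) : Prop := YM M i l ∧ ¬ YM M k l

def Rl (M : ℤ → ℤ → Prop) (p q r t : Pt) : Prop :=
  ∃ i j k l, Inn M i j k l ∧
    ((¬ Top M i k l ∧ ((p = (i, j) ∧ q = (k, l)) ∨ (p = (k, l) ∧ q = (i, j))) ∧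
        r = (i, l) ∧ t = (k, j)) ∨
     (Top M i k l ∧ ((p = (i, l) ∧ q = (k, j)) ∨ (p = (k, j) ∧ q = (i, l))) ∧
        r = (i, j) ∧ t = (k, l)))

def Step (M : ℤ → ℤ → Prop) (m m' : Pt →₀ ℕ) : Prop :=
  ∃ u p q r t, Rl M p q r t ∧ m = u + (ee p + ee q) ∧ m' = u + (ee r + ee t)

def Jn (M : ℤ → ℤ → Prop) (a b : Pt →₀ ℕ) : Prop :=
  ∃ c, Relation.ReflTransGen (Step M) a c ∧ Relation.ReflTransGen (Step M) b c

def Sy (M : ℤ → ℤ → Prop) (a b : Pt →₀ ℕ) : Prop := Step M a b ∨ Step M b a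

section
variable {M : ℤ → ℤ → Prop}

lemma Jn.symm {a b : Pt →₀ ℕ} (h : Jn M a b) : Jn M b a := by
  obtain ⟨c, h1, h2⟩ := h
  exact ⟨c, h2, h1⟩

lemma Sy.jn {a b : Pt →₀ ℕ} (h : Sy M a b) : Jn M a b := by
  rcases h with h | h
  · exact ⟨b, .single h, .refl⟩
  · exact ⟨a, .refl, .single h⟩

lemma Sy.symm' {a b : Pt →₀ ℕ} (h : Sy M a b) : Sy M b a := Or.symm h

lemma Step.sy {a b : Pt →₀ ℕ} (h : Step M a b) : Sy M a b := Or.inl h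

lemma jn_mid {a m b : Pt →₀ ℕ} (h : Step M a m) (h' : Sy M m b) : Jn M a b := by
  rcases h' with h' | h'
  · exact ⟨b, (Relation.ReflTransGen.single h).tail h', .refl⟩
  · exact ⟨m, .single h, .single h'⟩

lemma stepD {i j k l : ℤ} (h : Inn M i j k l) (ht : ¬ Top M i k l) (v : Pt) {x y : Pt →₀ ℕ}
    (hx : x = ee v + (ee (i, j) + ee (k, l))) (hy : y = ee v + (ee (i, l) + ee (k, j))) :
    Step M x y :=
  ⟨ee v, _, _, _, _, ⟨i, j, k, l, h, Or.inl ⟨ht, Or.inl ⟨rfl, rfl⟩, rfl, rfl⟩⟩, hx, hy⟩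

lemma stepA {i j k l : ℤ} (h : Inn M i j k l) (ht : Top M i k l) (v : Pt) {x y : Pt →₀ ℕ}
    (hx : x = ee v + (ee (i, l) + ee (k, j))) (hy : y = ee v + (ee (i, j) + ee (k, l))) :
    Step M x y :=
  ⟨ee v, _, _, _, _, ⟨i, j, k, l, h, Or.inr ⟨ht, Or.inl ⟨rfl, rfl⟩, rfl, rfl⟩⟩, hx, hy⟩

lemma sy {i j k l : ℤ} (h : Inn M i j k l) (v : Pt) {x y : Pt →₀ ℕ}
    (hx : x = ee v + (ee (i, l) + ee (k, j))) (hy : y = ee v + (ee (i, j) + ee (k, l))) :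
    Sy M x y := by
  by_cases ht : Top M i k l
  · exact Or.inl (stepA h ht v hx hy)
  · exact Or.inr (stepD h ht v hy hx)

lemma sy' {i j k l : ℤ} (h : Inn M i j k l) (v : Pt) {x y : Pt →₀ ℕ}
    (hx : x = ee v + (ee (i, j) + ee (k, l))) (hy : y = ee v + (ee (i, l) + ee (k, j))) :
    Sy M x y := by
  rcases sy h v hy hx with h | h
  · exact Or.inr h
  · exact Or.inl h

lemma Inn.sub {i j k l i' j' k' l' : ℤ} (h : Inn M i j k l) (h1 : i ≤ i') (h2 : i' < k')
    (h3 : k' ≤ k) (h4 : j ≤ j') (h5 : j' < l') (h6 : l' ≤ l) : Inn M i' j' k' l' :=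
  ⟨h2, h5, fun x y _ _ _ _ => h.2.2 x y (by omega) (by omega) (by omega) (by omega)⟩

lemma Inn.at {i j k l : ℤ} (h : Inn M i j k l) (x y : ℤ) (h1 : i ≤ x) (h2 : x < k)
    (h3 : j ≤ y) (h4 : y < l) : M x y := h.2.2 x y h1 h2 h3 h4

/-- horizontal gluing -/
lemma Inn.glueH {i j k l k' : ℤ} (h : Inn M i j k l) (h' : Inn M k j k' l) :
    Inn M i j k' l := by
  have := h.1
  have := h'.1
  refine ⟨by omega, h.2.1, fun x y a b c d => ?_⟩
  rcases lt_or_ge x k with hx | hx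
  · exact h.2.2 x y a hx c d
  · exact h'.2.2 x y hx b c d

/-- vertical gluing -/
lemma Inn.glueV {i j k l l' : ℤ} (h : Inn M i j k l) (h' : Inn M i l k l') :
    Inn M i j k l' := by
  have := h.2.1
  have := h'.2.1
  refine ⟨h.1, by omega, fun x y a b c d => ?_⟩
  rcases lt_or_ge y l with hx | hx
  · exact h.2.2 x y a b c hx
  · exact h'.2.2 x y a b hx d

lemma Inn.cell {x y : ℤ} (h : M x y) : Inn M x y (x+1) (y+1) := by
  refine ⟨by omega, by omega, fun a b _ _ _ _ => ?_⟩
  obtain rfl : a = x := by omega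
  obtain rfl : b = y := by omega
  exact h

variable (H : Loc M)
include H

lemma Inn.thin {i j k l : ℤ} (h : Inn M i j k l) : k = i + 1 ∨ l = j + 1 := by
  have h1 := h.1
  have h2 := h.2.1
  by_contra! hc
  apply H.sq i j <;> apply h.2.2 <;> omega

lemma cp_aa {i j k l k' l' : ℤ} (h1 : Inn M i j k l) (h2 : Inn M i j k' l')
    (t1 : ¬ Top M i k l) (t2 : ¬ Top M i k' l') (hlt : k < k' ∨ (k = k' ∧ l < l')) :
    Jn M (ee (k', l') + (ee (i, l) + ee (k, j))) (ee (k, l) + (ee (i, l') + ee (k', j))) := by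
  have a1 := h1.1
  have a2 := h1.2.1
  have a3 := h2.1
  have a4 := h2.2.1
  have th := h2.thin H
  rcases hlt with hk | ⟨rfl, hl⟩
  · rcases lt_trichotomy l l' with hl | rfl | hl
    · omega
    · exact (sy' (h2.sub (i' := k) (j' := j) (k' := k') (l' := l) (by omega) hk le_rfl le_rfl
        a2 le_rfl) (i, l) (by abel) (by abel)).jn
    · refine (jn_mid (m := ee (i, l) + ee (k, l') + ee (k', j))
        (stepD (h1.sub (i' := i) (j' := l') (k' := k) (l' := l) le_rfl a1 le_rfl (by omega) hl
          le_rfl) t1 (k', j) (by abel) (by abel))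
        (sy (h2.sub (i' := k) (j' := j) (k' := k') (l' := l') (by omega) hk le_rfl le_rfl
        a4 le_rfl) (i, l) (by abel) (by abel))).symm
  · exact (sy (h2.sub (i' := i) (j' := l) (k' := k) (l' := l') le_rfl a1 le_rfl (by omega)
        hl le_rfl) (k, j) (by abel) (by abel)).jn.symm

lemma cp_bb {i j k l i' j' : ℤ} (h1 : Inn M i j k l) (h2 : Inn M i' j' k l)
    (hlt : i < i' ∨ (i = i' ∧ j < j')) :
    Jn M (ee (i', j') + (ee (i, l) + ee (k, j))) (ee (i, j) + (ee (i', l) + ee (k, j'))) := by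
  have a1 := h1.1
  have a2 := h1.2.1
  have a3 := h2.1
  have a4 := h2.2.1
  have th := h1.thin H
  rcases hlt with hk | ⟨rfl, hl⟩
  · rcases lt_trichotomy j j' with hl | rfl | hl
    · omega
    · exact (sy (h1.sub (i' := i) (j' := j) (k' := i') (l' := l) le_rfl hk (by omega) le_rfl
        a2 le_rfl) (k, j) (by abel) (by abel)).jn
    · have c1 : ¬ Top M i' k j := by
        intro h
        have := C1 H (h1.at (i' - 1) j (by omega) (by omega) le_rfl a2)
        rw [sub_add_cancel] at this
        exact this h.1
      exact jn_mid (m := ee (i, l) + ee (i', j) + ee (k, j'))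
        (stepD (h2.sub (i' := i') (j' := j') (k' := k) (l' := j) le_rfl a3 le_rfl le_rfl hl
          (by omega)) c1 (i, l) (by abel) (by abel))
        (sy (h1.sub (i' := i) (j' := j) (k' := i') (l' := l) le_rfl hk (by omega) le_rfl
        a2 le_rfl) (k, j') (by abel) (by abel))
  · exact (sy' (h1.sub (i' := i) (j' := j) (k' := k) (l' := j') le_rfl a1 le_rfl le_rfl
        hl (by omega)) (i, l) (by abel) (by abel)).jn.symm

lemma cp_cc {i j k l k' j' : ℤ} (h1 : Inn M i j k l) (h2 : Inn M i j' k' l)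
    (t1 : Top M i k l) (hlt : k < k' ∨ (k = k' ∧ j < j')) :
    Jn M (ee (k', j') + (ee (i, j) + ee (k, l))) (ee (k, j) + (ee (i, j') + ee (k', l))) := by
  have a1 := h1.1
  have a2 := h1.2.1
  have a3 := h2.1
  have a4 := h2.2.1
  have th := h2.thin H
  rcases hlt with hk | ⟨rfl, hl⟩
  · rcases lt_trichotomy j j' with hl | rfl | hl
    · have th1 := h1.thin H
      obtain rfl : k = i + 1 := by omega
      obtain rfl : l = j' + 1 := by omega
      have b1 := h2.at i j' (by omega) (by omega) (by omega) (by omega)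
      have b2 := h2.at (i+1) j' (by omega) (by omega) (by omega) (by omega)
      have b3 := h1.at i (j'-1) (by omega) (by omega) (by omega) (by omega)
      have c1 := C1 H b1
      rcases H.tl i j' b1 b2 b3 with ⟨b4, b5⟩ | ⟨b4, b5⟩
      · exfalso
        apply t1.2
        right; left
        exact ⟨Mc b5 (by ring) (by ring), Mc b3 (by ring) (by ring), Mc b1 (by ring) (by ring),
          Mc b2 (by ring) (by ring)⟩
      · have t : Top M i (i+1) j' := ⟨Or.inr (Or.inr (Or.inr ⟨b3, b1, b2, b4⟩)), c1⟩
        exact (jn_mid (m := ee (k', j' + 1) + ee (i, j) + ee (i+1, j'))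
          (stepA (h1.sub (i' := i) (j' := j) (k' := i+1) (l' := j') le_rfl a1 le_rfl le_rfl hl
            (by omega)) t (k', j'+1) (by abel) (by abel))
          (sy (h2.sub (i' := i+1) (j' := j') (k' := k') (l' := j'+1) (by omega) hk le_rfl
            le_rfl a4 le_rfl) (i, j) (by abel) (by abel)).symm').symm
    · exact (sy (h2.sub (i' := k) (j' := j) (k' := k') (l' := l) (by omega) hk le_rfl le_rfl
        a2 le_rfl) (i, j) (by abel) (by abel)).jn
    · omega
  · exact (sy (h1.sub (i' := i) (j' := j) (k' := k) (l' := j') le_rfl a1 le_rfl le_rfl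
        hl (by omega)) (k, l) (by abel) (by abel)).jn.symm

lemma cp_dd {i j k l i' l' : ℤ} (h1 : Inn M i j k l) (h2 : Inn M i' j k l')
    (t2 : Top M i' k l') (hlt : i < i' ∨ (i = i' ∧ l < l')) :
    Jn M (ee (i', l') + (ee (i, j) + ee (k, l))) (ee (i, l) + (ee (i', j) + ee (k, l'))) := by
  have a1 := h1.1
  have a2 := h1.2.1
  have a3 := h2.1
  have a4 := h2.2.1
  have th := h1.thin H
  rcases hlt with hk | ⟨rfl, hl⟩
  · rcases lt_trichotomy l l' with hl | rfl | hl
    · exact jn_mid (m := ee (i, j) + ee (i', l) + ee (k, l'))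
        (stepA (h2.sub (i' := i') (j' := l) (k' := k) (l' := l') le_rfl a3 le_rfl (by omega) hl
          le_rfl) t2 (i, j) (by abel) (by abel))
        (sy' (h1.sub (i' := i) (j' := j) (k' := i') (l' := l) le_rfl hk (by omega) le_rfl
        a2 le_rfl) (k, l') (by abel) (by abel))
    · exact (sy' (h1.sub (i' := i) (j' := j) (k' := i') (l' := l) le_rfl hk (by omega) le_rfl
        a2 le_rfl) (k, l) (by abel) (by abel)).jn
    · omega
  · exact (stepA (h2.sub (i' := i) (j' := l) (k' := k) (l' := l') le_rfl a1 le_rfl (by omega)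
        hl le_rfl) t2 (i, j) (by abel) (by abel)).sy.jn

/-- `c = d'` is impossible. -/
lemma cp_cd {i k l i' l' : ℤ} (h2 : Inn M i' l i l') (t1 : Top M i k l) : False := by
  have a3 := h2.1
  have a4 := h2.2.1
  have := C1 H (h2.at (i-1) l (by omega) (by omega) le_rfl (by omega))
  rw [sub_add_cancel] at this
  exact this t1.1

/-- `a = c'` -/
lemma cp_ac {i j k l k' j' : ℤ} (h1 : Inn M i j k l) (h2 : Inn M i j' k' j)
    (t1 : ¬ Top M i k l) (t2 : Top M i k' j) :
    Jn M (ee (k', j') + (ee (i, l) + ee (k, j))) (ee (k, l) + (ee (i, j') + ee (k', j))) := by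
  have a1 := h1.1
  have a2 := h1.2.1
  have a3 := h2.1
  have a4 := h2.2.1
  have th := h1.thin H
  rcases lt_trichotomy k k' with hk | rfl | hk
  · have g := (h2.sub (i' := i) (j' := j') (k' := k) (l' := j) le_rfl a1 (by omega) le_rfl a4
      le_rfl).glueV h1
    exact (jn_mid (m := ee (k', j) + ee (i, l) + ee (k, j'))
      (stepD g t1 (k', j) (by abel) (by abel))
      (sy (h2.sub (i' := k) (j' := j') (k' := k') (l' := j) (by omega) hk le_rfl le_rfl a4
        le_rfl) (i, l) (by abel) (by abel)).symm').symm
  · exact (sy (h2.glueV h1) (k, j) (by abel) (by abel)).jn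
  · exfalso
    obtain rfl : l = j + 1 := by omega
    have b1 := h1.at i j (by omega) (by omega) (by omega) (by omega)
    have b2 := h1.at (i+1) j (by omega) (by omega) (by omega) (by omega)
    have b3 := h2.at i (j-1) (by omega) (by omega) (by omega) (by omega)
    rcases H.tl i j b1 b2 b3 with ⟨b4, b5⟩ | ⟨b4, b5⟩
    · exact C5 H b1 b2 b3 b4 t2.1
    · apply t1
      constructor
      · right; right; left
        exact ⟨Mc b3 (by ring) (by ring), Mc b1 (by ring) (by ring), Mc b2 (by ring) (by ring), b4⟩
      · have := C3 H (h1.at (k-1) j (by omega) (by omega) (by omega) (by omega))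
          (h1.at (k-1-1) j (by omega) (by omega) (by omega) (by omega))
        rwa [sub_add_cancel] at this

/-- `a = d'` -/
lemma cp_ad {i j k l i' l' : ℤ} (h1 : Inn M i j k l) (h2 : Inn M i' j i l')
    (t1 : ¬ Top M i k l) (t2 : Top M i' i l') :
    Jn M (ee (i', l') + (ee (i, l) + ee (k, j))) (ee (k, l) + (ee (i', j) + ee (i, l'))) := by
  have a1 := h1.1
  have a2 := h1.2.1
  have a3 := h2.1
  have a4 := h2.2.1
  rcases lt_trichotomy l l' with hk | rfl | hk
  · have g := (h2.sub (i' := i') (j' := j) (k' := i) (l' := l) le_rfl a3 (by omega) le_rfl a2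
      (by omega)).glueH h1
    exact (jn_mid (m := ee (k, j) + ee (i', l) + ee (i, l'))
      (stepA (h2.sub (i' := i') (j' := l) (k' := i) (l' := l') le_rfl a3 le_rfl (by omega) hk
        le_rfl) t2 (k, j) (by abel) (by abel))
      (sy g (i, l') (by abel) (by abel)))
  · exact (sy (h2.glueH h1) (i, l) (by abel) (by abel)).jn
  · have g := h2.glueH (h1.sub (i' := i) (j' := j) (k' := k) (l' := l') le_rfl a1 le_rfl le_rfl a4
      (by omega))
    exact (jn_mid (m := ee (i', j) + ee (i, l) + ee (k, l'))
      (stepD (h1.sub (i' := i) (j' := l') (k' := k) (l' := l) le_rfl a1 le_rfl (by omega) hk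
        le_rfl) t1 (i', j) (by abel) (by abel))
      (sy' g (i, l) (by abel) (by abel))).symm

/-- `b = c'` -/
lemma cp_bc {i j k l k' j' : ℤ} (h1 : Inn M i j k l) (h2 : Inn M k j' k' l)
    (t2 : Top M k k' l) :
    Jn M (ee (k', j') + (ee (i, l) + ee (k, j))) (ee (i, j) + (ee (k, j') + ee (k', l))) := by
  have a1 := h1.1
  have a2 := h1.2.1
  have a3 := h2.1
  have a4 := h2.2.1
  have th := h1.thin H
  have th2 := h2.thin H
  have b1 := h1.at (k-1) (l-1) (by omega) (by omega) (by omega) (by omega)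
  have b2 := h2.at k (l-1) (by omega) (by omega) (by omega) (by omega)
  rcases lt_trichotomy j j' with hk | rfl | hk
  · obtain rfl : k = i + 1 := by omega
    have b1' := h1.at i (l-1) (by omega) (by omega) (by omega) (by omega)
    have b3 := h1.at i (l-1-1) (by omega) (by omega) (by omega) (by omega)
    have hj : j' = l - 1 := by
      have := H.sq i (l-2)
      by_contra hne
      apply H.sq i (l-2)
      · exact Mc b3 rfl (by ring)
      · exact h2.at _ _ (by omega) (by omega) (by omega) (by omega)
      · exact Mc b1' rfl (by ring)
      · exact Mc b2 rfl (by ring)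
    subst hj
    rcases H.tl i (l-1) b1' b2 b3 with ⟨b4, b5⟩ | ⟨b4, b5⟩
    · have t : ¬ Top M i (i+1) (l-1) := fun h => C5 H b1' b2 b3 b4 h.1
      have g := (h1.sub (i' := i) (j' := l-1) (k' := i+1) (l' := l) le_rfl a1 le_rfl (by omega) a4
        le_rfl).glueH h2
      exact (jn_mid (m := ee (k', l) + ee (i, l-1) + ee (i+1, j))
        (stepD (h1.sub (i' := i) (j' := j) (k' := i+1) (l' := l-1) le_rfl a1 le_rfl le_rfl hk
          (by omega)) t (k', l) (by abel) (by abel))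
        (sy' g (i+1, j) (by abel) (by abel))).symm
    · have := C4 H b1' b2 b3 b5
      rw [sub_add_cancel] at this
      exact absurd t2.1 this
  · exact (sy (h1.glueH h2) (k, j) (by abel) (by abel)).jn
  · exfalso
    have := C2 H b2 b1 (h2.at k (l-1-1) (by omega) (by omega) (by omega) (by omega))
    rw [sub_add_cancel] at this
    exact this t2.1

/-- `b = d'` -/
lemma cp_bd {i j k l i' l' : ℤ} (h1 : Inn M i j k l) (h2 : Inn M i' l k l')
    (t2 : Top M i' k l') :
    Jn M (ee (i', l') + (ee (i, l) + ee (k, j))) (ee (i, j) + (ee (i', l) + ee (k, l'))) := by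
  have a1 := h1.1
  have a2 := h1.2.1
  have a3 := h2.1
  have a4 := h2.2.1
  have th2 := h2.thin H
  rcases lt_trichotomy i i' with hk | rfl | hk
  · have g := (h1.sub (i' := i') (j' := j) (k' := k) (l' := l) (by omega) a3 (by omega) le_rfl a2
      (by omega)).glueV h2
    exact (jn_mid (m := ee (i, l) + ee (i', j) + ee (k, l'))
      (stepA g t2 (i, l) (by abel) (by abel))
      (sy (h1.sub (i' := i) (j' := j) (k' := i') (l' := l) (by omega) hk (by omega) le_rfl a2
        le_rfl) (k, l') (by abel) (by abel)))
  · exact (sy (h1.glueV h2) (i, l) (by abel) (by abel)).jn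
  · have g := h1.glueV (h2.sub (i' := i) (j' := l) (k' := k) (l' := l') (by omega) a1 le_rfl
      le_rfl a4 (by omega))
    obtain rfl : l' = l + 1 := by omega
    have t : ¬ Top M i k (l+1) := by
      intro h
      have hi : i = k - 1 := by
        by_contra hne
        apply H.sq (k-2) (l-1)
        · exact h1.at _ _ (by omega) (by omega) (by omega) (by omega)
        · exact h1.at _ _ (by omega) (by omega) (by omega) (by omega)
        · exact h2.at _ _ (by omega) (by omega) (by omega) (by omega)
        · exact h2.at _ _ (by omega) (by omega) (by omega) (by omega)
      subst hi
      exact C2 H (h2.at (k-1) l (by omega) (by omega) (by omega) (by omega))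
        (h2.at (k-1-1) l (by omega) (by omega) (by omega) (by omega))
        (h1.at (k-1) (l-1) (by omega) (by omega) (by omega) (by omega)) h.1
    exact (jn_mid (m := ee (i', l) + ee (i, l+1) + ee (k, j))
      (stepD g t (i', l) (by abel) (by abel))
      (sy' (h2.sub (i' := i') (j' := l) (k' := i) (l' := l+1) (by omega) hk (by omega) le_rfl a4
        le_rfl) (k, j) (by abel) (by abel))).symm

/-- `b = a'` -/
lemma cp_ba {i j k l k' l' : ℤ} (h1 : Inn M i j k l) (h2 : Inn M k l k' l')
    (t1 : ¬ Top M i k l) (t2 : ¬ Top M k k' l') :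
    Jn M (ee (k', l') + (ee (i, l) + ee (k, j))) (ee (i, j) + (ee (k, l') + ee (k', l))) := by
  have a1 := h1.1
  have a2 := h1.2.1
  have a3 := h2.1
  have a4 := h2.2.1
  have th1 := h1.thin H
  have th2 := h2.thin H
  have b1 := h1.at (k-1) (l-1) (by omega) (by omega) (by omega) (by omega)
  have b2 := h2.at k l (by omega) (by omega) (by omega) (by omega)
  rcases H.dg1 (k-1) (l-1) b1 (Mc b2 (by ring) (by ring)) with b3 | b3
  · -- lower right cell
    have b3 : M k (l-1) := Mc b3 (by ring) rfl
    have hk : k' = k + 1 := by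
      by_contra hne
      obtain rfl : l' = l + 1 := by omega
      have b4 := h2.at (k+1) l (by omega) (by omega) (by omega) (by omega)
      rcases H.tl k l b2 b4 b3 with ⟨b5, b6⟩ | ⟨b5, b6⟩
      · apply t2
        constructor
        · left
          exact ⟨Mc b1 (by ring) (by ring), Mc b3 (by ring) (by ring), Mc b2 (by ring) (by ring),
            Mc b4 (by ring) (by ring)⟩
        · have := C3 H (h2.at (k'-1) l (by omega) (by omega) (by omega) (by omega))
            (h2.at (k'-1-1) l (by omega) (by omega) (by omega) (by omega))
          rwa [sub_add_cancel] at this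
      · exact H.n3 k (l-1) b3 b1 (Mc b6 (by ring) (by ring)) (Mc b2 (by ring) (by ring))
    have hj : j = l - 1 := by
      by_contra hne
      obtain rfl : i = k - 1 := by omega
      have b4 := h1.at (k-1) (l-1-1) (by omega) (by omega) (by omega) (by omega)
      have b3' : M (k-1+1) (l-1) := Mc b3 (by ring) rfl
      rcases H.tl (k-1) (l-1) b1 b3' b4 with ⟨b5, b6⟩ | ⟨b5, b6⟩
      · exact H.n1 k (l-1) b3 b1 (Mc b5 (by ring) (by ring)) (Mc b2 (by ring) (by ring))
      · apply t1
        constructor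
        · right; right; left
          exact ⟨Mc b4 (by ring) (by ring), Mc b1 (by ring) (by ring), Mc b3 (by ring) (by ring),
            Mc b2 (by ring) (by ring)⟩
        · have := C4 H b1 b3' b4 b6
          rwa [sub_add_cancel, sub_add_cancel] at this
    subst hk
    subst hj
    have cl : Inn M k (l-1) (k+1) l := by
      have := Inn.cell b3
      rwa [sub_add_cancel] at this
    exact jn_mid (m := ee (i, l) + ee (k, l') + ee (k+1, l-1))
      (stepD (cl.glueV h2) t2 (i, l) (by abel) (by abel))
      (sy (h1.glueH cl) (k, l') (by abel) (by abel))
  · -- upper left cell: impossible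
    exfalso
    have b3 : M (k-1) l := Mc b3 rfl (by ring)
    have c1 := C1 H b3
    rw [sub_add_cancel] at c1
    have b2' : M (k-1+1) l := Mc b2 (by ring) rfl
    rcases H.tl (k-1) l b3 b2' b1 with ⟨b5, b6⟩ | ⟨b5, b6⟩
    · have hl : l' = l + 1 := by
        by_contra hne
        exact H.n1 k l b2 b3 (Mc b5 (by ring) (by ring))
          (h2.at _ _ (by omega) (by omega) (by omega) (by omega))
      subst hl
      apply t2
      constructor
      · right; left
        exact ⟨Mc b6 (by ring) (by ring), Mc b1 (by ring) (by ring), Mc b3 (by ring) (by ring),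
            Mc b2 (by ring) (by ring)⟩
      · have b7 : M (k'-1-1) l := by
          by_cases hh : k' = k + 1
          · exact Mc b3 (by omega) rfl
          · exact h2.at _ _ (by omega) (by omega) (by omega) (by omega)
        have := C3 H (h2.at (k'-1) l (by omega) (by omega) (by omega) (by omega)) b7
        rwa [sub_add_cancel] at this
    · have hi : i = k - 1 := by
        by_contra hne
        exact H.n3 (k-1) (l-1) b1
          (h1.at _ _ (by omega) (by omega) (by omega) (by omega)) (Mc b6 (by ring) (by ring))
          (Mc b3 (by ring) (by ring))
      subst hi
      apply t1
      refine ⟨?_, c1⟩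
      right; right; right
      exact ⟨b1, b3, b2', b5⟩

end

section
variable {M : ℤ → ℤ → Prop}

lemma Rl.swap {p q r t : Pt} (h : Rl M p q r t) : Rl M q p r t := by
  obtain ⟨i, j, k, l, hI, ⟨ht, h, h'⟩ | ⟨ht, h, h'⟩⟩ := h
  · exact ⟨i, j, k, l, hI, Or.inl ⟨ht, h.symm.imp And.symm And.symm, h'⟩⟩
  · exact ⟨i, j, k, l, hI, Or.inr ⟨ht, h.symm.imp And.symm And.symm, h'⟩⟩

lemma Rl.ne {p q r t : Pt} (h : Rl M p q r t) : p ≠ q := by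
  obtain ⟨i, j, k, l, hI, ⟨ht, ⟨rfl, rfl⟩ | ⟨rfl, rfl⟩, h'⟩ | ⟨ht, ⟨rfl, rfl⟩ | ⟨rfl, rfl⟩, h'⟩⟩ := h
  all_goals
    have := hI.1
    simp only [ne_eq, Prod.mk.injEq]
    omega

lemma Rl.uniq {p q r t r' t' : Pt} (h : Rl M p q r t) (h' : Rl M p q r' t') :
    r = r' ∧ t = t' := by
  obtain ⟨i, j, k, l, hI, ⟨ht, ⟨rfl, rfl⟩ | ⟨rfl, rfl⟩, rfl, rfl⟩ |
    ⟨ht, ⟨rfl, rfl⟩ | ⟨rfl, rfl⟩, rfl, rfl⟩⟩ := h <;>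
  obtain ⟨i', j', k', l', hI', ⟨ht', ⟨h1, h2⟩ | ⟨h1, h2⟩, rfl, rfl⟩ |
    ⟨ht', ⟨h1, h2⟩ | ⟨h1, h2⟩, rfl, rfl⟩⟩ := h' <;>
  · have a1 := hI.1
    have a2 := hI.2.1
    have a3 := hI'.1
    have a4 := hI'.2.1
    simp only [Prod.mk.injEq] at h1 h2 ⊢
    omega

variable (H : Loc M)
include H

lemma cp_all {s q r t q' r' t' : Pt} (h : Rl M s q r t) (h' : Rl M s q' r' t') (hne : q ≠ q') :
    Jn M (ee q' + (ee r + ee t)) (ee q + (ee r' + ee t')) := by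
  obtain ⟨i, j, k, l, hI, ⟨ht, ⟨rfl, rfl⟩ | ⟨rfl, rfl⟩, rfl, rfl⟩ |
    ⟨ht, ⟨rfl, rfl⟩ | ⟨rfl, rfl⟩, rfl, rfl⟩⟩ := h <;>
  obtain ⟨i', j', k', l', hI', ⟨ht', ⟨h1, rfl⟩ | ⟨h1, rfl⟩, rfl, rfl⟩ |
    ⟨ht', ⟨h1, rfl⟩ | ⟨h1, rfl⟩, rfl, rfl⟩⟩ := h' <;>
  obtain ⟨rfl, rfl⟩ := Prod.mk.inj h1 <;>
  simp only [ne_eq, Prod.mk.injEq] at hne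
  · -- aa
    have : (k < k' ∨ (k = k' ∧ l < l')) ∨ (k' < k ∨ (k' = k ∧ l' < l)) := by omega
    rcases this with h | h
    · exact cp_aa H hI hI' ht ht' h
    · exact (cp_aa H hI' hI ht' ht h).symm
  · exact (cp_ba H hI' hI ht' ht).symm
  · exact cp_ac H hI hI' ht ht'
  · exact cp_ad H hI hI' ht ht'
  · exact cp_ba H hI hI' ht ht'
  · have : (i < i' ∨ (i = i' ∧ j < j')) ∨ (i' < i ∨ (i' = i ∧ j' < j)) := by omega
    rcases this with h | h
    · exact cp_bb H hI hI' h
    · exact (cp_bb H hI' hI h).symm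
  · exact cp_bc H hI hI' ht'
  · exact cp_bd H hI hI' ht'
  · exact (cp_ac H hI' hI ht' ht).symm
  · exact (cp_bc H hI' hI ht).symm
  · have : (k < k' ∨ (k = k' ∧ j < j')) ∨ (k' < k ∨ (k' = k ∧ j' < j)) := by omega
    rcases this with h | h
    · exact cp_cc H hI hI' ht h
    · exact (cp_cc H hI' hI ht' h).symm
  · exact (cp_cd H hI' ht).elim
  · exact (cp_ad H hI' hI ht' ht).symm
  · exact (cp_bd H hI' hI ht).symm
  · exact (cp_cd H hI ht').elim
  · have : (i < i' ∨ (i = i' ∧ l < l')) ∨ (i' < i ∨ (i' = i ∧ l' < l)) := by omega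
    rcases this with h | h
    · exact cp_dd H hI hI' ht' h
    · exact (cp_dd H hI' hI ht h).symm

omit H

lemma Step.add {a b : Pt →₀ ℕ} (v : Pt →₀ ℕ) (h : Step M a b) : Step M (v + a) (v + b) := by
  obtain ⟨u, p, q, r, t, hr, rfl, rfl⟩ := h
  exact ⟨v + u, p, q, r, t, hr, by abel, by abel⟩

lemma rtg_add {a b : Pt →₀ ℕ} (v : Pt →₀ ℕ) (h : Relation.ReflTransGen (Step M) a b) :
    Relation.ReflTransGen (Step M) (v + a) (v + b) := by
  induction h with
  | refl => exact .refl
  | tail _ h ih => exact ih.tail (h.add v)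

lemma Jn.add {a b : Pt →₀ ℕ} (v : Pt →₀ ℕ) (h : Jn M a b) : Jn M (v + a) (v + b) := by
  obtain ⟨c, h1, h2⟩ := h
  exact ⟨v + c, rtg_add v h1, rtg_add v h2⟩

lemma ee_split {m : Pt →₀ ℕ} {p : Pt} (h : m p ≠ 0) : ∃ v, m = v + ee p :=
  ⟨m - ee p, (tsub_add_cancel_of_le (by simpa [ee] using Nat.one_le_iff_ne_zero.mpr h)).symm⟩

lemma ee_self (p : Pt) : ee p p = 1 := by simp [ee]

lemma ee_ne {p q : Pt} (h : p ≠ q) : ee p q = 0 := by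
  simp [ee, Finsupp.single_apply, h]

include H

lemma lc_share {s q r t q' r' t' : Pt} {u u' : Pt →₀ ℕ} (h : Rl M s q r t)
    (h' : Rl M s q' r' t') (e : u + (ee s + ee q) = u' + (ee s + ee q')) :
    Jn M (u + (ee r + ee t)) (u' + (ee r' + ee t')) := by
  have e2 : u + ee q = u' + ee q' := by
    have : (u + ee q) + ee s = (u' + ee q') + ee s := by
      calc _ = u + (ee s + ee q) := by abel
        _ = _ := by rw [e]; abel
    exact add_right_cancel this
  by_cases hq : q = q'
  · subst hq
    obtain ⟨rfl, rfl⟩ := h.uniq h'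
    have := add_right_cancel e2
    subst this
    exact ⟨_, .refl, .refl⟩
  · have h0 : u q' ≠ 0 := by
      have := DFunLike.congr_fun e2 q'
      simp only [Finsupp.add_apply, ee_self, ee_ne hq] at this
      omega
    obtain ⟨v, rfl⟩ := ee_split h0
    have : u' = v + ee q := by
      apply add_right_cancel (b := ee q')
      rw [← e2]; abel
    subst this
    have := (cp_all H h h' hq).add v
    simpa only [add_assoc] using this

lemma loc_conf {m a b : Pt →₀ ℕ} (h : Step M m a) (h' : Step M m b) : Jn M a b := by
  obtain ⟨u, p, q, r, t, hr, rfl, rfl⟩ := h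
  obtain ⟨u', p', q', r', t', hr', e, rfl⟩ := h'
  by_cases h1 : p = p'
  · subst h1
    exact lc_share H hr hr' e
  by_cases h2 : p = q'
  · subst h2
    exact lc_share H hr hr'.swap (e.trans (by abel))
  by_cases h3 : q = p'
  · subst h3
    exact lc_share H hr.swap hr' (Eq.trans (by abel) e)
  by_cases h4 : q = q'
  · subst h4
    exact lc_share H hr.swap hr'.swap (Eq.trans (by abel) (e.trans (by abel)))
  have h5 := hr'.ne
  have e1 : u p' ≠ 0 := by
    have := DFunLike.congr_fun e p'
    simp only [Finsupp.add_apply, ee_self, ee_ne h1, ee_ne h3] at this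
    omega
  obtain ⟨v, rfl⟩ := ee_split e1
  have e2 : v q' ≠ 0 := by
    have := DFunLike.congr_fun e q'
    simp only [Finsupp.add_apply, ee_self, ee_ne h2, ee_ne h4, ee_ne h5] at this
    omega
  obtain ⟨v, rfl⟩ := ee_split e2
  have : u' = v + (ee p + ee q) := by
    apply add_right_cancel (b := ee p' + ee q')
    rw [← e]; abel
  subst this
  refine ⟨v + (ee r + ee t) + (ee r' + ee t'), .single ?_, .single ?_⟩
  · exact ⟨v + (ee r + ee t), p', q', r', t', hr', by abel, by abel⟩
  · exact ⟨v + (ee r' + ee t'), p, q, r, t, hr, by abel, by abel⟩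

omit H

lemma rtg_mono {μ : (Pt →₀ ℕ) → ℕ} (hμ : ∀ a b, Step M a b → μ b < μ a) {a b : Pt →₀ ℕ}
    (h : Relation.ReflTransGen (Step M) a b) : μ b ≤ μ a := by
  induction h with
  | refl => exact le_rfl
  | tail _ h ih => exact (hμ _ _ h).le.trans ih

lemma nf_exists {μ : (Pt →₀ ℕ) → ℕ} (hμ : ∀ a b, Step M a b → μ b < μ a) :
    ∀ n m, μ m = n → ∃ x, Relation.ReflTransGen (Step M) m x ∧ ∀ y, ¬ Step M x y := by
  intro n
  induction n using Nat.strong_induction_on with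
  | _ n ih =>
    intro m hm
    by_cases h : ∃ y, Step M m y
    · obtain ⟨y, hy⟩ := h
      obtain ⟨x, h1, h2⟩ := ih (μ y) (hm ▸ hμ _ _ hy) y rfl
      exact ⟨x, .head hy h1, h2⟩
    · push Not at h
      exact ⟨m, .refl, h⟩

include H
lemma nf_unique {μ : (Pt →₀ ℕ) → ℕ} (hμ : ∀ a b, Step M a b → μ b < μ a) :
    ∀ n m, μ m = n → ∀ x x', Relation.ReflTransGen (Step M) m x → (∀ y, ¬ Step M x y) →
      Relation.ReflTransGen (Step M) m x' → (∀ y, ¬ Step M x' y) → x = x' := by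
  intro n
  induction n using Nat.strong_induction_on with
  | _ n ih =>
    intro m hm x x' h1 h2 h3 h4
    rcases h1.cases_head with rfl | ⟨a, ha, hax⟩
    · rcases h3.cases_head with rfl | ⟨b, hb, hbx⟩
      · rfl
      · exact absurd hb (h2 _)
    · rcases h3.cases_head with rfl | ⟨b, hb, hbx⟩
      · exact absurd ha (h4 _)
      · obtain ⟨c, hc, hc'⟩ := loc_conf H ha hb
        obtain ⟨z, hz, hz'⟩ := nf_exists hμ _ c rfl
        have e1 := ih _ (hm ▸ hμ _ _ ha) a rfl x z hax h2 (hc.trans hz) hz'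
        have e2 := ih _ (hm ▸ hμ _ _ hb) b rfl x' z hbx h4 (hc'.trans hz) hz'
        rw [e1, e2]

lemma nf_main {μ : (Pt →₀ ℕ) → ℕ} (hμ : ∀ a b, Step M a b → μ b < μ a) :
    ∃ nf : (Pt →₀ ℕ) → (Pt →₀ ℕ), (∀ m, Relation.ReflTransGen (Step M) m (nf m)) ∧
      (∀ m, (∀ y, ¬ Step M m y) → nf m = m) ∧ ∀ a b, Step M a b → nf a = nf b := by
  choose nf h1 h2 using fun m => nf_exists hμ _ m rfl
  refine ⟨nf, h1, fun m hm => ?_, fun a b hab => ?_⟩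
  · exact nf_unique H hμ _ m rfl _ _ (h1 m) (h2 m) .refl hm
  · exact nf_unique H hμ _ a rfl _ _ (h1 a) (h2 a) (.head hab (h1 b)) (h2 b)

end

/-! ### The orders -/

section
variable {Y : Set Pt}

lemma Ylt.trans {a b c : Pt} (h : Ylt Y a b) (h' : Ylt Y b c) : Ylt Y a c := by
  unfold Ylt lt1 at *
  by_cases ha : a ∈ Y <;> by_cases hb : b ∈ Y <;> by_cases hc : c ∈ Y <;>
    simp only [ha, hb, hc, not_true_eq_false, not_false_eq_true, true_and, false_and, and_false,
      or_false, false_or, and_true, true_or] at h h' ⊢ <;> omega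

lemma Ylt.irrefl (a : Pt) : ¬ Ylt Y a a := by
  unfold Ylt lt1
  by_cases ha : a ∈ Y <;> simp [ha]

lemma Ylt.tri (a b : Pt) : Ylt Y a b ∨ a = b ∨ Ylt Y b a := by
  unfold Ylt lt1
  by_cases ha : a ∈ Y <;> by_cases hb : b ∈ Y <;>
    simp only [ha, hb, not_true_eq_false, not_false_eq_true, true_and, false_and, and_false,
      or_false, false_or, and_true, true_or, or_true, Prod.ext_iff] <;> omega

lemma lexLt.trans {u v x : Pt →₀ ℕ} (h : lexLt (Ylt Y) u v) (h' : lexLt (Ylt Y) v x) :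
    lexLt (Ylt Y) u x := by
  obtain ⟨w, h1, h2⟩ := h
  obtain ⟨w', h1', h2'⟩ := h'
  rcases Ylt.tri (Y := Y) w w' with hw | rfl | hw
  · exact ⟨w', by rw [h2 _ hw]; exact h1', fun z hz => by rw [h2 _ (hw.trans hz), h2' _ hz]⟩
  · exact ⟨w, h1.trans h1', fun z hz => by rw [h2 _ hz, h2' _ hz]⟩
  · exact ⟨w, by rw [← h2' _ hw]; exact h1, fun z hz => by rw [h2 _ hz, h2' _ (hw.trans hz)]⟩

lemma lexLt.irrefl (u : Pt →₀ ℕ) : ¬ lexLt (Ylt Y) u u := by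
  rintro ⟨w, h, _⟩
  exact lt_irrefl _ h

lemma lexLt.add {u v : Pt →₀ ℕ} (x : Pt →₀ ℕ) (h : lexLt (Ylt Y) u v) :
    lexLt (Ylt Y) (x + u) (x + v) := by
  obtain ⟨w, h1, h2⟩ := h
  refine ⟨w, by simpa using h1, fun z hz => by simp [h2 z hz]⟩

end

/-- The largest variable of a rule is in its lead. -/
lemma Rl.big {M : ℤ → ℤ → Prop} (H : Loc M) {Y : Set Pt} (hY : ∀ x y, (x, y) ∈ Y ↔ YM M x y)
    {p q r t : Pt} (h : Rl M p q r t) :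
    ∃ s o, ee p + ee q = ee s + ee o ∧ Ylt Y o s ∧ Ylt Y r s ∧ Ylt Y t s := by
  obtain ⟨i, j, k, l, hI, h⟩ := h
  have a1 := hI.1
  have a2 := hI.2.1
  have d : (k, j) ∉ Y := by
    rw [hY]
    have := C1 H (hI.at (k-1) j (by omega) (by omega) le_rfl (by omega))
    rwa [sub_add_cancel] at this
  rcases h with ⟨ht, hpq, rfl, rfl⟩ | ⟨ht, hpq, rfl, rfl⟩
  · have e : ee p + ee q = ee (k, l) + ee (i, j) := by
      rcases hpq with ⟨rfl, rfl⟩ | ⟨rfl, rfl⟩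
      · abel
      · rfl
    unfold Top at ht
    rw [← hY, ← hY] at ht
    by_cases hb : (k, l) ∈ Y
    · refine ⟨(k, l), (i, j), e, ?_, ?_, ?_⟩
      · by_cases ha : (i, j) ∈ Y
        · exact Or.inr (Or.inr ⟨ha, hb, Or.inl a1⟩)
        · exact Or.inl ⟨ha, hb⟩
      · by_cases ha : (i, l) ∈ Y
        · exact Or.inr (Or.inr ⟨ha, hb, Or.inl a1⟩)
        · exact Or.inl ⟨ha, hb⟩
      · exact Or.inl ⟨d, hb⟩
    · have hc : (i, l) ∉ Y := fun h => ht ⟨h, hb⟩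
      by_cases ha : (i, j) ∈ Y
      · exact ⟨(i, j), (k, l), e.trans (add_comm _ _), Or.inl ⟨hb, ha⟩, Or.inl ⟨hc, ha⟩,
          Or.inl ⟨d, ha⟩⟩
      · exact ⟨(k, l), (i, j), e, Or.inr (Or.inl ⟨ha, hb, Or.inl a1⟩),
          Or.inr (Or.inl ⟨hc, hb, Or.inl a1⟩), Or.inr (Or.inl ⟨d, hb, Or.inr ⟨rfl, a2⟩⟩)⟩
  · have e : ee p + ee q = ee (i, l) + ee (k, j) := by
      rcases hpq with ⟨rfl, rfl⟩ | ⟨rfl, rfl⟩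
      · rfl
      · abel
    unfold Top at ht
    rw [← hY, ← hY] at ht
    obtain ⟨hc, hb⟩ := ht
    refine ⟨(i, l), (k, j), e, Or.inl ⟨d, hc⟩, ?_, Or.inl ⟨hb, hc⟩⟩
    by_cases ha : (i, j) ∈ Y
    · exact Or.inr (Or.inr ⟨ha, hc, Or.inr ⟨rfl, a2⟩⟩)
    · exact Or.inl ⟨ha, hc⟩

lemma Ylt.ne {Y : Set Pt} {a b : Pt} (h : Ylt Y a b) : a ≠ b := by
  rintro rfl
  exact Ylt.irrefl _ h

lemma Rl.lex {M : ℤ → ℤ → Prop} (H : Loc M) {Y : Set Pt} (hY : ∀ x y, (x, y) ∈ Y ↔ YM M x y)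
    {p q r t : Pt} (h : Rl M p q r t) : lexLt (Ylt Y) (ee r + ee t) (ee p + ee q) := by
  obtain ⟨s, o, e, h1, h2, h3⟩ := h.big H hY
  rw [e]
  refine ⟨s, ?_, fun z hz => ?_⟩
  · simp [ee_self, ee_ne h1.ne, ee_ne h2.ne, ee_ne h3.ne]
  · simp [ee_ne hz.ne, ee_ne (h1.trans hz).ne, ee_ne (h2.trans hz).ne, ee_ne (h3.trans hz).ne]

lemma Step.lex {M : ℤ → ℤ → Prop} (H : Loc M) {Y : Set Pt} (hY : ∀ x y, (x, y) ∈ Y ↔ YM M x y)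
    {a b : Pt →₀ ℕ} (h : Step M a b) : lexLt (Ylt Y) b a := by
  obtain ⟨u, p, q, r, t, hr, rfl, rfl⟩ := h
  exact (hr.lex H hY).add u

lemma rtg_lex {M : ℤ → ℤ → Prop} (H : Loc M) {Y : Set Pt} (hY : ∀ x y, (x, y) ∈ Y ↔ YM M x y)
    {a b : Pt →₀ ℕ} (h : Relation.ReflTransGen (Step M) a b) : lexLe (Ylt Y) b a := by
  induction h with
  | refl => exact Or.inl rfl
  | tail _ h ih =>
    rcases ih with rfl | ih
    · exact Or.inr (h.lex H hY)
    · exact Or.inr ((h.lex H hY).trans ih)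

open Classical in
lemma exists_weight {M : ℤ → ℤ → Prop} (H : Loc M) {Y : Set Pt}
    (hY : ∀ x y, (x, y) ∈ Y ↔ YM M x y) (V : Finset Pt)
    (hV : ∀ p q r t, Rl M p q r t → r ∈ V ∧ t ∈ V) :
    ∃ μ : (Pt →₀ ℕ) → ℕ, ∀ a b, Step M a b → μ b < μ a := by
  let rk : Pt → ℕ := fun v => (V.filter fun u => Ylt Y u v).card
  have hrk : ∀ a b, a ∈ V → Ylt Y a b → rk a < rk b := by
    intro a b ha hab
    apply Finset.card_lt_card
    refine ⟨fun x hx => ?_, fun hs => ?_⟩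
    · rw [Finset.mem_filter] at hx ⊢
      exact ⟨hx.1, hx.2.trans hab⟩
    · have := hs (Finset.mem_filter.mpr ⟨ha, hab⟩)
      exact Ylt.irrefl _ (Finset.mem_filter.mp this).2
  let μ : (Pt →₀ ℕ) →+ ℕ := Finsupp.liftAddHom fun v => (AddMonoidHom.mulRight (2 ^ rk v))
  have hμ : ∀ p, μ (ee p) = 2 ^ rk p := by
    intro p
    simp [μ, ee]
  refine ⟨μ, ?_⟩
  rintro a b ⟨u, p, q, r, t, hr, rfl, rfl⟩
  obtain ⟨s, o, e, h1, h2, h3⟩ := hr.big H hY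
  obtain ⟨v1, v2⟩ := hV _ _ _ _ hr
  rw [e]
  simp only [map_add, hμ]
  have i1 := hrk _ _ v1 h2
  have i2 := hrk _ _ v2 h3
  have j1 : 2 ^ (rk r + 1) ≤ 2 ^ rk s := Nat.pow_le_pow_right (by norm_num) i1
  have j2 : 2 ^ (rk t + 1) ≤ 2 ^ rk s := Nat.pow_le_pow_right (by norm_num) i2
  have j3 : 0 < 2 ^ rk o := by positivity
  rw [pow_succ] at j1 j2
  omega

/-! ### Polynomials -/

lemma innerMinor_eq (K : Type*) [Field K] (a b : Pt) :
    innerMinor K a b = monomial (ee a + ee b) (1 : K)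
      - monomial (ee (a.1, b.2) + ee (b.1, a.2)) (1 : K) := by
  unfold innerMinor ee
  simp only [X, monomial_mul, mul_one]

lemma innerMinor_rule (K : Type*) [Field K] {P : Finset Pt} {a b : Pt}
    (h : IsInnerInterval P a b) :
    ∃ p q r t, Rl (fun x y => (x, y) ∈ P) p q r t ∧
      ((innerMinor K a b = monomial (ee p + ee q) (1 : K) - monomial (ee r + ee t) (1 : K)) ∨
      (innerMinor K a b = -(monomial (ee p + ee q) (1 : K) - monomial (ee r + ee t) (1 : K)))) := by
  have hI : Inn (fun x y => (x, y) ∈ P) a.1 a.2 b.1 b.2 :=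
    ⟨h.1, h.2.1, fun x y h1 h2 h3 h4 => h.2.2 (x, y) h1 h2 h3 h4⟩
  by_cases ht : Top (fun x y => (x, y) ∈ P) a.1 b.1 b.2
  · refine ⟨(a.1, b.2), (b.1, a.2), a, b, ⟨_, _, _, _, hI, Or.inr ⟨ht, Or.inl ⟨rfl, rfl⟩, rfl, rfl⟩⟩,
      Or.inr ?_⟩
    rw [innerMinor_eq, neg_sub]
  · refine ⟨a, b, (a.1, b.2), (b.1, a.2), ⟨_, _, _, _, hI, Or.inl ⟨ht, Or.inl ⟨rfl, rfl⟩, rfl, rfl⟩⟩,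
      Or.inl ?_⟩
    rw [innerMinor_eq]

lemma rule_minor (K : Type*) [Field K] {P : Finset Pt} {p q r t : Pt}
    (h : Rl (fun x y => (x, y) ∈ P) p q r t) :
    ∃ g ∈ minorsSet K P,
      (g = monomial (ee p + ee q) (1 : K) - monomial (ee r + ee t) (1 : K)) ∨
      (g = -(monomial (ee p + ee q) (1 : K) - monomial (ee r + ee t) (1 : K))) := by
  obtain ⟨i, j, k, l, hI, h⟩ := h
  refine ⟨innerMinor K (i, j) (k, l), ⟨(i, j), (k, l), ⟨hI.1, hI.2.1,
    fun c h1 h2 h3 h4 => hI.2.2 c.1 c.2 h1 h2 h3 h4⟩, rfl⟩, ?_⟩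
  rw [innerMinor_eq]
  rcases h with ⟨ht, ⟨rfl, rfl⟩ | ⟨rfl, rfl⟩, rfl, rfl⟩ | ⟨ht, ⟨rfl, rfl⟩ | ⟨rfl, rfl⟩, rfl, rfl⟩
  · exact Or.inl rfl
  · exact Or.inl (by rw [add_comm (ee (k, l))])
  · exact Or.inr (by rw [neg_sub])
  · exact Or.inr (by rw [neg_sub, add_comm (ee (k, j))])

lemma isLM_unique {K : Type*} [Field K] {Y : Set Pt} {f : MvPolynomial Pt K} {m m' : Pt →₀ ℕ}
    (h : IsLM (Ylt Y) f m) (h' : IsLM (Ylt Y) f m') : m = m' := by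
  rcases h.2 _ h'.1 with e | e
  · exact e.symm
  · rcases h'.2 _ h.1 with e' | e'
    · exact e'
    · exact absurd (e.trans e') (lexLt.irrefl _)

open Classical in
lemma binom_LM {K : Type*} [Field K] {Y : Set Pt} {L T : Pt →₀ ℕ} (h : lexLt (Ylt Y) T L)
    {f : MvPolynomial Pt K} (hf : (f = monomial L (1 : K) - monomial T (1 : K)) ∨
      (f = -(monomial L (1 : K) - monomial T (1 : K)))) :
    IsLM (Ylt Y) f L ∧ (f.coeff L = 1 ∨ f.coeff L = -1) := by
  have hne : T ≠ L := by
    rintro rfl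
    exact lexLt.irrefl _ h
  have hc : f.coeff L = 1 ∨ f.coeff L = -1 := by
    rcases hf with rfl | rfl
    · left; simp [coeff_monomial, hne]
    · right; simp [coeff_monomial, hne]
  refine ⟨⟨?_, fun m hm => ?_⟩, hc⟩
  · rw [mem_support_iff]
    rcases hc with h | h <;> rw [h] <;> simp
  · by_cases h1 : m = L
    · exact Or.inl h1
    · by_cases h2 : m = T
      · exact Or.inr (h2 ▸ h)
      · exfalso
        rw [mem_support_iff] at hm
        apply hm
        rcases hf with rfl | rfl <;> simp [coeff_monomial, Ne.symm h1, Ne.symm h2]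

open Classical in
lemma innerMinor_support {K : Type*} [Field K] {a b : Pt} {m : Pt →₀ ℕ}
    (h : m ∈ (innerMinor K a b).support) :
    m = ee a + ee b ∨ m = ee (a.1, b.2) + ee (b.1, a.2) := by
  by_contra! hc
  rw [mem_support_iff, innerMinor_eq] at h
  apply h
  simp [coeff_monomial, Ne.symm hc.1, Ne.symm hc.2]

lemma ee2_le {a b c d : Pt} (h : ee a + ee b ≤ ee c + ee d) (hab : a ≠ b) :
    (a = c ∧ b = d) ∨ (a = d ∧ b = c) := by
  have h1 : a = c ∨ a = d := by
    by_contra! hc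
    have := h a
    simp [ee_self, ee_ne hc.1.symm, ee_ne hc.2.symm, ee_ne hab.symm] at this
  have h2 : b = c ∨ b = d := by
    by_contra! hc
    have := h b
    simp [ee_self, ee_ne hc.1.symm, ee_ne hc.2.symm, ee_ne hab] at this
  rcases h1 with h1 | h1 <;> rcases h2 with h2 | h2
  · exact absurd (h1.trans h2.symm) hab
  · exact Or.inl ⟨h1, h2⟩
  · exact Or.inr ⟨h1, h2⟩
  · exact absurd (h1.trans h2.symm) hab

lemma minors_eq {a b c d : Pt} {m m' : Pt →₀ ℕ} (h1 : a.1 < b.1) (h2 : a.2 < b.2) (h3 : c.1 < d.1)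
    (h4 : c.2 < d.2) (hm : m = ee a + ee b ∨ m = ee (a.1, b.2) + ee (b.1, a.2))
    (hm' : m' = ee c + ee d ∨ m' = ee (c.1, d.2) + ee (d.1, c.2)) (hle : m' ≤ m) :
    c = a ∧ d = b := by
  rcases hm with rfl | rfl <;> rcases hm' with rfl | rfl <;>
  · have := ee2_le hle (by rw [Ne, Prod.ext_iff]; (try simp only); omega)
    simp only [Prod.ext_iff] at this ⊢
    omega

section
variable {K : Type*} [Field K]

lemma psi_vanish {P : Finset Pt} (ψ : MvPolynomial Pt K →ₗ[K] K)
    (hψ : ∀ a b, Step (fun x y => (x, y) ∈ P) a b →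
      ψ (monomial a (1 : K)) = ψ (monomial b (1 : K)))
    {f : MvPolynomial Pt K} (hf : f ∈ polyoIdeal K P) : ψ f = 0 := by
  have key : ∀ g ∈ minorsSet K P, ∀ q : MvPolynomial Pt K, ψ (q * g) = 0 := by
    rintro g ⟨a, b, hab, rfl⟩ q
    obtain ⟨p, q', r, t, hr, hg⟩ := innerMinor_rule K hab
    have hmon : ∀ (u : Pt →₀ ℕ) (c : K), ψ (monomial u c * (monomial (ee p + ee q') (1 : K)
        - monomial (ee r + ee t) (1 : K))) = 0 := by
      intro u c
      have e := hψ _ _ ⟨u, p, q', r, t, hr, rfl, rfl⟩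
      rw [mul_sub, monomial_mul, monomial_mul, mul_one]
      have hs : ∀ s : Pt →₀ ℕ, monomial s c = c • monomial s (1 : K) := by
        intro s
        rw [smul_monomial, smul_eq_mul, mul_one]
      rw [hs, hs (u + (ee r + ee t)), map_sub, map_smul, map_smul, e, sub_self]
    have hq : ∀ q : MvPolynomial Pt K, ψ (q * (monomial (ee p + ee q') (1 : K)
        - monomial (ee r + ee t) (1 : K))) = 0 := by
      intro q
      induction q using MvPolynomial.induction_on' with
      | monomial u c => exact hmon u c
      | add q1 q2 h1 h2 => rw [add_mul, map_add, h1, h2, add_zero]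
    rcases hg with hg | hg
    · rw [hg]; exact hq q
    · rw [hg, mul_neg, map_neg, hq q, neg_zero]
  have : ∀ q : MvPolynomial Pt K, ψ (q * f) = 0 := by
    unfold polyoIdeal at hf
    induction hf using Submodule.span_induction with
    | mem x h => exact key x h
    | zero => intro q; simp
    | add x y _ _ h1 h2 => intro q; rw [mul_add, map_add, h1, h2, add_zero]
    | smul a x _ h => intro q; rw [smul_eq_mul, ← mul_assoc]; exact h _
  simpa using this 1

end

theorem reducedGB_of_no_WPentomino_xy
    (K : Type*) [Field K] (P : Finset Pt) (hP : IsClosedPath P)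
    (hW : ¬ ∃ a₁ a₂ A : Pt, IsWPentomino P a₁ a₂ A) :
    IsReducedGroebnerBasis (Ylt (YtetXY P)) (minorsSet K P) (polyoIdeal K P) := by
  classical
  have H := loc_of_closedPath hP hW
  have hY := mem_Y_iff P
  have hLM : ∀ g ∈ minorsSet K P, ∃ m, IsLM (Ylt (YtetXY P)) g m ∧
      (g.coeff m = 1 ∨ g.coeff m = -1) := by
    rintro g ⟨a, b, hab, rfl⟩
    obtain ⟨p, q, r, t, hr, hg⟩ := innerMinor_rule K hab
    exact ⟨_, binom_LM (hr.lex H hY) hg⟩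
  refine ⟨⟨rfl, le_antisymm ?_ ?_⟩, hLM, ?_⟩
  · apply Ideal.span_mono
    rintro f ⟨g, hg, m, hm, rfl⟩
    exact ⟨g, Ideal.subset_span hg, m, hm, rfl⟩
  · apply Ideal.span_le.mpr
    rintro _ ⟨f, hf, m, hm, rfl⟩
    by_cases hs : ∃ y, Step (fun x y => (x, y) ∈ P) m y
    · obtain ⟨y, u, p, q, r, t, hr, rfl, rfl⟩ := hs
      obtain ⟨g, hg, hg'⟩ := rule_minor K hr
      have h1 := (binom_LM (hr.lex H hY) hg').1
      have : monomial (u + (ee p + ee q)) (1 : K) =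
          monomial u 1 * monomial (ee p + ee q) (1 : K) := by
        rw [monomial_mul, mul_one]
      rw [this]
      exact Ideal.mul_mem_left _ _ (Ideal.subset_span ⟨g, hg, _, h1, rfl⟩)
    · exfalso
      push Not at hs
      let V : Finset Pt := P.biUnion fun a =>
        {a, (a.1 + 1, a.2), (a.1, a.2 + 1), (a.1 + 1, a.2 + 1)}
      have hV : ∀ p q r t, Rl (fun x y => (x, y) ∈ P) p q r t → r ∈ V ∧ t ∈ V := by
        rintro p q r t ⟨i, j, k, l, hI, h⟩
        have a1 := hI.1
        have a2 := hI.2.1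
        have v1 : (i, j) ∈ V := Finset.mem_biUnion.mpr ⟨(i, j), hI.at i j le_rfl a1 le_rfl a2,
          by simp⟩
        have v2 : (k, l) ∈ V := Finset.mem_biUnion.mpr ⟨(k-1, l-1), hI.at (k-1) (l-1) (by omega)
          (by omega) (by omega) (by omega), by simp⟩
        have v3 : (i, l) ∈ V := Finset.mem_biUnion.mpr ⟨(i, l-1), hI.at i (l-1) (by omega)
          (by omega) (by omega) (by omega), by simp⟩
        have v4 : (k, j) ∈ V := Finset.mem_biUnion.mpr ⟨(k-1, j), hI.at (k-1) j (by omega)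
          (by omega) (by omega) (by omega), by simp⟩
        rcases h with ⟨_, _, rfl, rfl⟩ | ⟨_, _, rfl, rfl⟩
        · exact ⟨v3, v4⟩
        · exact ⟨v1, v2⟩
      obtain ⟨μ, hμ⟩ := exists_weight H hY V hV
      obtain ⟨nf, n1, n2, n3⟩ := nf_main H hμ
      let ψ : MvPolynomial Pt K →ₗ[K] K :=
        (basisMonomials Pt K).constr K fun a => if nf a = m then (1 : K) else 0
      have hψ : ∀ a, ψ (monomial a (1 : K)) = if nf a = m then (1 : K) else 0 := by
        intro a
        have := (basisMonomials Pt K).constr_basis K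
          (fun a => if nf a = m then (1 : K) else 0) a
        rwa [coe_basisMonomials] at this
      have h0 : ψ f = 0 := psi_vanish ψ (fun a b hab => by rw [hψ, hψ, n3 a b hab]) hf
      have h1 : ψ f = f.coeff m := by
        conv_lhs => rw [f.as_sum]
        rw [map_sum, Finset.sum_eq_single m]
        · have : monomial m (f.coeff m) = f.coeff m • monomial m (1 : K) := by
            rw [smul_monomial, smul_eq_mul, mul_one]
          rw [this, map_smul, hψ, if_pos (n2 m hs), smul_eq_mul, mul_one]
        · intro m' hm' hne
          have : monomial m' (f.coeff m') = f.coeff m' • monomial m' (1 : K) := by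
            rw [smul_monomial, smul_eq_mul, mul_one]
          rw [this, map_smul, hψ, if_neg, smul_zero]
          intro e
          have hl : lexLt (Ylt (YtetXY P)) m' m := (hm.2 m' hm').resolve_left hne
          have hl' := rtg_lex H hY (n1 m')
          rw [e] at hl'
          rcases hl' with h | h
          · exact hne h.symm
          · exact lexLt.irrefl _ (h.trans hl)
        · intro h
          exact absurd hm.1 h
      exact (mem_support_iff.mp hm.1) (h1.symm.trans h0)
  · rintro _ ⟨a, b, hab, rfl⟩ _ ⟨c, d, hcd, rfl⟩ hne m hm m' hm' hle
    obtain ⟨rfl, rfl⟩ := minors_eq hab.1 hab.2.1 hcd.1 hcd.2.1 (innerMinor_support hm)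
      (innerMinor_support hm'.1) hle
    exact hne rfl

end ClosedPathPaper
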